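/- Let f ∈ C^p(ℝⁿ) (p ≥ 2) with ‖∇ᵖf(x) − ∇ᵖf(y)‖ ≤ (p−1)!·L·‖x−y‖. Consider an iteration with σ_min ≤ σ_k ≤ σ_max, at which s_k ≠ 0 satisfies T_p(x_k,0) − T_p(x_k,s_k) ≥ (σ_k/(p+1))‖s_k‖^{p+1}, max(0, −λ_min(∇²_s m(x_k,s_k,σ_k))) ≤ θ‖s_k‖^{p−2}·‖s_k‖ (i.e. ≤ θ‖s_k‖^{p−1}), and f(x_k) − f(x_k+s_k) ≥ η₁·(T_p(x_k,0) − T_p(x_k,s_k)). If λ_min(∇²f(x_k+s_k)) < −ε₂, then f(x_k) − f(x_k+s_k) ≥ (η₁σ_min/(p+1))·(ε₂/((p−1)L+θ+pσ_max))^{(p+1)/(p−1)}. -/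

import Mathlib

open scoped BigOperators

/-- The degree-`p` Taylor polynomial of `f` at `x`, evaluated at increment `s`. -/
noncomputable def taylorP {n : ℕ} (p : ℕ) (f : EuclideanSpace ℝ (Fin n) → ℝ)
    (x s : EuclideanSpace ℝ (Fin n)) : ℝ :=
  ∑ j ∈ Finset.range (p + 1),
    (1 / (j.factorial : ℝ)) * iteratedFDeriv ℝ j f x (fun _ => s)

/-- The regularized Taylor model `m(x,s,σ) = T_p(x,s) + (σ/(p+1))‖s‖^{p+1}`. -/
noncomputable def modelM {n : ℕ} (p : ℕ) (f : EuclideanSpace ℝ (Fin n) → ℝ)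
    (x s : EuclideanSpace ℝ (Fin n)) (σ : ℝ) : ℝ :=
  taylorP p f x s + σ / ((p : ℝ) + 1) * ‖s‖ ^ (p + 1)

/-- The leftmost eigenvalue of the Hessian of `g` at `z`, via the Rayleigh quotient. -/
noncomputable def lambdaMin {n : ℕ} (g : EuclideanSpace ℝ (Fin n) → ℝ)
    (z : EuclideanSpace ℝ (Fin n)) : ℝ :=
  sInf {r : ℝ | ∃ y : EuclideanSpace ℝ (Fin n), ‖y‖ = 1 ∧ iteratedFDeriv ℝ 2 g z ![y, y] = r}

section Taylor

universe u

variable {E F : Type u} [NormedAddCommGroup E] [NormedSpace ℝ E]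
  [NormedAddCommGroup F] [NormedSpace ℝ F]

/-- The degree-`q` Taylor polynomial at `x` of a vector-valued function, at increment `s`. -/
noncomputable def taylorSum (q : ℕ) (g : E → F) (x s : E) : F :=
  ∑ j ∈ Finset.range (q + 1), (1 / (j.factorial : ℝ)) • iteratedFDeriv ℝ j g x (fun _ => s)

theorem iteratedFDeriv_fderiv_fderiv_flip {n : ℕ} {f : E → F}
    (hf : ContDiff ℝ (n + 2 : ℕ) f) (x : E) (m : Fin n → E) (u v : E) :
    iteratedFDeriv ℝ n (fderiv ℝ (fderiv ℝ f)) x m u v =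
      iteratedFDeriv ℝ n (fderiv ℝ (fderiv ℝ f)) x m v u := by
  let φ : (E →L[ℝ] E →L[ℝ] F) →L[ℝ] (E →L[ℝ] E →L[ℝ] F) :=
    (ContinuousLinearMap.flipₗᵢ ℝ E E F).toContinuousLinearEquiv.toContinuousLinearMap
  have hφ : ⇑φ ∘ fderiv ℝ (fderiv ℝ f) = fderiv ℝ (fderiv ℝ f) := by
    ext z a b
    have hz : IsSymmSndFDerivAt ℝ f z := hf.contDiffAt.isSymmSndFDerivAt (by
      simp only [minSmoothness_of_isRCLikeNormedField]; exact_mod_cast (by omega : 2 ≤ n + 2))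
    exact hz.eq b a
  have hD : ContDiff ℝ n (fderiv ℝ (fderiv ℝ f)) :=
    (hf.fderiv_right (m := (n + 1 : ℕ)) (by norm_cast)).fderiv_right (by norm_cast)
  have h := ContinuousLinearMap.iteratedFDeriv_comp_left (F := E →L[ℝ] E →L[ℝ] F)
    (G := E →L[ℝ] E →L[ℝ] F) φ hD.contDiffAt (x := x) (i := n) le_rfl
  rw [hφ] at h
  exact congrArg (fun A => A m u v) h

theorem iteratedFDeriv_apply_update_const {n : ℕ} {f : E → F}
    (hf : ContDiff ℝ (n + 1 : ℕ) f) (x s h : E) (i : Fin (n + 1)) :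
    iteratedFDeriv ℝ (n + 1) f x (Function.update (fun _ => s) i h) =
      iteratedFDeriv ℝ n (fderiv ℝ f) x (fun _ => s) h := by
  induction n generalizing F with
  | zero => simp [Fin.fin_one_eq_zero i]
  | succ n ih =>
    rw [iteratedFDeriv_succ_apply_right]
    induction i using Fin.lastCases with
    | last => rw [Fin.init_update_last, Function.update_self]; rfl
    | cast i =>
      rw [Fin.init_update_castSucc, Function.update_of_ne (Fin.castSucc_lt_last i).ne']
      have hinit : (Fin.init fun _ : Fin (n + 2) => s) = fun _ => s := rfl
      rw [hinit, ih (hf.fderiv_right (by norm_cast)), iteratedFDeriv_succ_apply_right,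
        iteratedFDeriv_fderiv_fderiv_flip hf]
      rfl

theorem hasFDerivAt_iteratedFDeriv_diag {n : ℕ} {f : E → F}
    (hf : ContDiff ℝ (n + 1 : ℕ) f) (x s : E) :
    HasFDerivAt (fun v => iteratedFDeriv ℝ (n + 1) f x (fun _ => v))
      (((n : ℝ) + 1) • iteratedFDeriv ℝ n (fderiv ℝ f) x (fun _ => s)) s := by
  have h := ContinuousMultilinearMap.hasFDerivAt (iteratedFDeriv ℝ (n + 1) f x) (fun _ => s)
  have hd : HasFDerivAt (fun (v : E) (_ : Fin (n + 1)) => v)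
      (ContinuousLinearMap.pi fun _ => ContinuousLinearMap.id ℝ E) s :=
    hasFDerivAt_pi.2 fun _ => hasFDerivAt_id s
  refine (h.comp s hd).congr_fderiv ?_
  ext v
  simp [ContinuousMultilinearMap.linearDeriv_apply, iteratedFDeriv_apply_update_const hf,
    ← Nat.cast_smul_eq_nsmul ℝ]

theorem hasFDerivAt_taylorSum_succ {q : ℕ} {g : E → F} (hg : ContDiff ℝ (q + 1 : ℕ) g) (x s : E) :
    HasFDerivAt (taylorSum (q + 1) g x) (taylorSum q (fderiv ℝ g) x s) s := by
  have hsum : taylorSum (q + 1) g x = fun v => (∑ j ∈ Finset.range (q + 1),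
      (1 / ((j + 1).factorial : ℝ)) • iteratedFDeriv ℝ (j + 1) g x (fun _ => v)) + g x := by
    ext v
    simp [taylorSum, Finset.sum_range_succ' _ (q + 1)]
  rw [hsum]
  refine HasFDerivAt.add_const _ (HasFDerivAt.fun_sum fun j hj => ?_)
  have hj' : j + 1 ≤ q + 1 := by simpa using hj
  refine ((hasFDerivAt_iteratedFDeriv_diag (n := j)
    (hg.of_le (by exact_mod_cast hj')) x s).const_smul _).congr_fderiv ?_
  rw [smul_smul, Nat.factorial_succ]
  congr 1
  push_cast
  field_simp

theorem taylorSum_at_zero (q : ℕ) (g : E → F) (x : E) : taylorSum q g x 0 = g x := by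
  have hz (j : ℕ) : iteratedFDeriv ℝ (j + 1) g x (fun _ => 0) = 0 :=
    (iteratedFDeriv ℝ (j + 1) g x).map_coord_zero 0 rfl
  simp [taylorSum, Finset.sum_range_succ', hz]

theorem norm_iteratedFDeriv_fderiv_sub {n : ℕ} (g : E → F) (x y : E) :
    ‖iteratedFDeriv ℝ n (fderiv ℝ g) x - iteratedFDeriv ℝ n (fderiv ℝ g) y‖ =
      ‖iteratedFDeriv ℝ (n + 1) g x - iteratedFDeriv ℝ (n + 1) g y‖ := by
  rw [iteratedFDeriv_succ_eq_comp_right, iteratedFDeriv_succ_eq_comp_right, Function.comp_apply,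
    Function.comp_apply, ← dist_eq_norm, ← dist_eq_norm, LinearIsometryEquiv.dist_map]

theorem norm_sub_taylorSum_le {q : ℕ} {g : E → F} (hg : ContDiff ℝ q g) {K : ℝ} {x : E}
    (hK : ∀ y, ‖iteratedFDeriv ℝ q g y - iteratedFDeriv ℝ q g x‖ ≤ K * ‖y - x‖) (s : E) :
    ‖g (x + s) - taylorSum q g x s‖ ≤ K * ‖s‖ ^ (q + 1) / ((q + 1).factorial : ℝ) := by
  induction q generalizing F s with
  | zero =>
    have h := hK (x + s)
    rw [iteratedFDeriv_zero_eq_comp] at h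
    simp only [Function.comp_apply, ← map_sub, LinearIsometryEquiv.norm_map] at h
    simpa [taylorSum] using h
  | succ q ih =>
    have hderiv (v : E) : HasFDerivAt (fun v => g (x + v) - taylorSum (q + 1) g x v)
        (fderiv ℝ g (x + v) - taylorSum q (fderiv ℝ g) x v) v := by
      refine HasFDerivAt.sub ?_ (hasFDerivAt_taylorSum_succ hg x v)
      exact (hasFDerivAt_comp_add_left x).2 (hg.differentiable (by simp) (x + v)).hasFDerivAt
    have hbound := ih (g := fderiv ℝ g) (hg.fderiv_right (by norm_cast))
      (fun y => by rw [norm_iteratedFDeriv_fderiv_sub]; exact hK y)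
    have hline (t : ℝ) : HasDerivAt (fun t : ℝ => g (x + t • s) - taylorSum (q + 1) g x (t • s))
        ((fderiv ℝ g (x + t • s) - taylorSum q (fderiv ℝ g) x (t • s)) s) t := by
      have ht : HasDerivAt (fun t : ℝ => t • s) s t := by
        simpa using (hasDerivAt_id t).smul_const s
      exact (hderiv (t • s)).comp_hasDerivAt t ht
    have hB (t : ℝ) : HasDerivAt
        (fun t : ℝ => K * ‖s‖ ^ (q + 2) / ((q + 2).factorial : ℝ) * t ^ (q + 2))
        (K * ‖s‖ ^ (q + 2) / ((q + 1).factorial : ℝ) * t ^ (q + 1)) t := by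
      refine ((hasDerivAt_pow (q + 2) t).const_mul _).congr_deriv ?_
      rw [Nat.factorial_succ (q + 1)]
      push_cast
      rw [show (q : ℝ) + 1 + 1 = q + 2 by ring]
      field_simp
    have := image_norm_le_of_norm_deriv_right_le_deriv_boundary (a := 0) (b := 1)
      (fun t _ => (hline t).continuousAt.continuousWithinAt)
      (fun t _ => (hline t).hasDerivWithinAt)
      (by simp [taylorSum_at_zero]) hB
      (fun t ht => by
        refine (ContinuousLinearMap.le_of_opNorm_le _ (hbound (t • s)) s).trans_eq ?_
        rw [norm_smul, Real.norm_of_nonneg ht.1, mul_pow]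
        ring) (Set.right_mem_Icc.2 zero_le_one)
    simpa using this

end Taylor

section NormPow

variable {E : Type*} [NormedAddCommGroup E] [InnerProductSpace ℝ E]

theorem hasFDerivAt_norm_pow_add_three (k : ℕ) (v : E) :
    HasFDerivAt (fun v : E => ‖v‖ ^ (k + 3))
      ((((k : ℝ) + 3) * ‖v‖ ^ (k + 1)) • innerSL ℝ v) v := by
  have h := hasFDerivAt_norm_rpow v (p := ((k + 3 : ℕ) : ℝ)) (by push_cast; linarith)
  have he : ((k + 3 : ℕ) : ℝ) - 2 = ((k + 1 : ℕ) : ℝ) := by push_cast; ring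
  rw [he] at h
  simp only [Real.rpow_natCast] at h
  exact_mod_cast h

theorem exists_hasFDerivAt_norm_pow_smul_innerSL (k : ℕ) {s : E} (hs : s ≠ 0) :
    ∃ B : E →L[ℝ] E →L[ℝ] ℝ,
      HasFDerivAt (fun v : E => ‖v‖ ^ (k + 1) • innerSL ℝ v) B s ∧
      ∀ y, B y y ≤ ((k : ℝ) + 2) * ‖s‖ ^ (k + 1) * ‖y‖ ^ 2 := by
  have hN : HasFDerivAt (fun v : E => ‖v‖) (fderiv ℝ (fun v : E => ‖v‖) s) s :=
    (differentiableAt_id.norm ℝ hs).hasFDerivAt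
  have hN1 : ‖fderiv ℝ (fun v : E => ‖v‖) s‖ ≤ 1 := by
    simpa using norm_fderiv_le_of_lipschitz ℝ (x₀ := s) (lipschitzWith_one_norm (E := E))
  have hI : HasFDerivAt (fun v : E => innerSL ℝ v) (innerSL ℝ) s := (innerSL ℝ).hasFDerivAt
  refine ⟨_, (hN.pow (k + 1)).smul hI, fun y => ?_⟩
  set N := fderiv ℝ (fun v : E => ‖v‖) s
  have h1 : N y * inner ℝ s y ≤ ‖y‖ * (‖s‖ * ‖y‖) := by
    refine (le_abs_self _).trans ?_
    rw [abs_mul]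
    have hNy : |N y| ≤ ‖y‖ := by simpa using N.le_of_opNorm_le hN1 y
    gcongr
    exact abs_real_inner_le_norm s y
  have h2 := mul_le_mul_of_nonneg_left h1 (by positivity : 0 ≤ ((k : ℝ) + 1) * ‖s‖ ^ k)
  have h3 : ‖s‖ ^ (k + 1) * inner ℝ y y = ‖s‖ ^ (k + 1) * ‖y‖ ^ 2 := by
    rw [real_inner_self_eq_norm_sq]
  simp only [add_apply, smul_apply, ContinuousLinearMap.smulRight_apply, Nat.cast_add, Nat.cast_one,
    add_tsub_cancel_right, smul_eq_mul, innerSL_apply_apply, nsmul_eq_mul]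
  change ‖s‖ ^ (k + 1) * inner ℝ y y + ((k : ℝ) + 1) * ‖s‖ ^ k * N y * inner ℝ s y ≤ _
  linear_combination h2 + h3

end NormPow

theorem lambdaMin_le {n : ℕ} (g : EuclideanSpace ℝ (Fin n) → ℝ) (z : EuclideanSpace ℝ (Fin n))
    {y : EuclideanSpace ℝ (Fin n)} (hy : ‖y‖ = 1) :
    lambdaMin g z ≤ iteratedFDeriv ℝ 2 g z ![y, y] := by
  refine csInf_le ⟨-‖iteratedFDeriv ℝ 2 g z‖, ?_⟩ ⟨y, hy, rfl⟩
  rintro _ ⟨w, hw, rfl⟩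
  have h := (iteratedFDeriv ℝ 2 g z).le_opNorm ![w, w]
  simp only [Fin.prod_univ_two, Matrix.cons_val_zero, Matrix.cons_val_one, hw, mul_one,
    Real.norm_eq_abs] at h
  exact (abs_le.1 h).1

theorem exists_unit_of_lambdaMin_lt {n : ℕ} {g : EuclideanSpace ℝ (Fin n) → ℝ}
    {z : EuclideanSpace ℝ (Fin n)} {c : ℝ} (hc : c ≤ 0) (h : lambdaMin g z < c) :
    ∃ y : EuclideanSpace ℝ (Fin n), ‖y‖ = 1 ∧ iteratedFDeriv ℝ 2 g z ![y, y] < c := by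
  have hne : {r : ℝ | ∃ y : EuclideanSpace ℝ (Fin n), ‖y‖ = 1 ∧
      iteratedFDeriv ℝ 2 g z ![y, y] = r}.Nonempty := by
    by_contra hempty
    rw [lambdaMin, Set.not_nonempty_iff_eq_empty.1 hempty, Real.sInf_empty] at h
    linarith
  obtain ⟨_, ⟨y, hy, rfl⟩, hlt⟩ := exists_lt_of_csInf_lt hne h
  exact ⟨y, hy, hlt⟩

/-- The Hessian of the model exceeds that of `f` by at most the Taylor remainder plus the
curvature of the regularization. -/
theorem iteratedFDeriv_two_modelM_le {n k : ℕ} {f : EuclideanSpace ℝ (Fin n) → ℝ} {L σ : ℝ}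
    (hσ : 0 ≤ σ) (hf : ContDiff ℝ (k + 2 : ℕ) f) {x : EuclideanSpace ℝ (Fin n)}
    (hLip : ∀ y, ‖iteratedFDeriv ℝ (k + 2) f y - iteratedFDeriv ℝ (k + 2) f x‖ ≤
      ((k + 1).factorial : ℝ) * L * ‖y - x‖)
    {s y : EuclideanSpace ℝ (Fin n)} (hs : s ≠ 0) (hy : ‖y‖ = 1) :
    iteratedFDeriv ℝ 2 (fun v => modelM (k + 2) f x v σ) s ![y, y] ≤
      iteratedFDeriv ℝ 2 f (x + s) ![y, y] + (L + ((k : ℝ) + 2) * σ) * ‖s‖ ^ (k + 1) := by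
  have hf1 : ContDiff ℝ (k + 1 : ℕ) (fderiv ℝ f) := hf.fderiv_right (by norm_cast)
  have hf2 : ContDiff ℝ k (fderiv ℝ (fderiv ℝ f)) := hf1.fderiv_right (by norm_cast)
  have hD1 : fderiv ℝ (fun v => modelM (k + 2) f x v σ) = fun v =>
      taylorSum (k + 1) (fderiv ℝ f) x v + σ • (‖v‖ ^ (k + 1) • innerSL ℝ v) := by
    ext1 v
    have h := (hasFDerivAt_taylorSum_succ hf x v).add
      ((hasFDerivAt_norm_pow_add_three k v).const_mul (σ / ((k + 2 : ℕ) + 1 : ℝ)))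
    refine (HasFDerivAt.congr_fderiv h ?_).fderiv
    rw [smul_smul, smul_smul]
    congr 2
    push_cast
    field_simp
    ring
  obtain ⟨B, hB, hBy⟩ := exists_hasFDerivAt_norm_pow_smul_innerSL k hs
  have hD2 : fderiv ℝ (fderiv ℝ (fun v => modelM (k + 2) f x v σ)) s =
      taylorSum k (fderiv ℝ (fderiv ℝ f)) x s + σ • B := by
    rw [hD1]
    exact ((hasFDerivAt_taylorSum_succ hf1 x s).add (hB.const_smul σ)).fderiv
  have hR := norm_sub_taylorSum_le hf2 (K := ((k + 1).factorial : ℝ) * L) (x := x)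
    (fun z => by
      rw [norm_iteratedFDeriv_fderiv_sub, norm_iteratedFDeriv_fderiv_sub]; exact hLip z) s
  have hR' : ‖fderiv ℝ (fderiv ℝ f) (x + s) - taylorSum k (fderiv ℝ (fderiv ℝ f)) x s‖ ≤
      L * ‖s‖ ^ (k + 1) := hR.trans_eq (by field_simp)
  have hRy := ContinuousLinearMap.le_of_opNorm₂_le_of_le _ hR' hy.le hy.le
  have hRy' := (abs_le.1 hRy).1
  have hBσ := mul_le_mul_of_nonneg_left (hBy y) hσ
  simp only [iteratedFDeriv_two_apply, Matrix.cons_val_zero, Matrix.cons_val_one, hD2,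
    add_apply, smul_apply, smul_eq_mul,
    sub_apply, hy] at *
  linarith

theorem stmt14 {n : ℕ} (p : ℕ) (hp : 2 ≤ p) (f : EuclideanSpace ℝ (Fin n) → ℝ)
    (L θ σk σmin σmax η₁ ε₂ : ℝ) (hL : 0 ≤ L) (hθ : 0 ≤ θ)
    (hσmin : 0 < σmin) (hσ₁ : σmin ≤ σk) (hσ₂ : σk ≤ σmax)
    (hη₁ : 0 < η₁) (hη₁' : η₁ < 1) (hε₂ : 0 < ε₂)
    (hf : ContDiff ℝ (p : ℕ∞) f)
    (hLip : ∀ x y : EuclideanSpace ℝ (Fin n),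
      ‖iteratedFDeriv ℝ p f x - iteratedFDeriv ℝ p f y‖ ≤ ((p - 1).factorial : ℝ) * L * ‖x - y‖)
    (x s : EuclideanSpace ℝ (Fin n)) (hs : s ≠ 0)
    (hdec : taylorP p f x 0 - taylorP p f x s ≥ σk / ((p : ℝ) + 1) * ‖s‖ ^ (p + 1))
    (hmodel : max 0 (-(lambdaMin (fun s' => modelM p f x s' σk) s)) ≤ θ * ‖s‖ ^ (p - 1))
    (hacc : f x - f (x + s) ≥ η₁ * (taylorP p f x 0 - taylorP p f x s))
    (hcrit : lambdaMin f (x + s) < -ε₂) :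
    f x - f (x + s) ≥
      η₁ * σmin / ((p : ℝ) + 1) *
        (ε₂ / (((p : ℝ) - 1) * L + θ + p * σmax)) ^ (((p : ℝ) + 1) / ((p : ℝ) - 1)) := by
  obtain ⟨k, rfl⟩ : ∃ k, p = k + 2 := ⟨p - 2, by omega⟩
  have hr : 0 < ‖s‖ := norm_pos_iff.2 hs
  have hσ : 0 < σk := hσmin.trans_le hσ₁
  obtain ⟨y, hy, hneg⟩ := exists_unit_of_lambdaMin_lt (by linarith) hcrit
  have hcomp := iteratedFDeriv_two_modelM_le hσ.le (hf.of_le le_rfl) (fun z => hLip z x) hs hy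
  have hlam := lambdaMin_le (fun v => modelM (k + 2) f x v σk) s hy
  have hθs := (le_max_right _ _).trans hmodel
  rw [show k + 2 - 1 = k + 1 by omega] at hθs
  have hp1 : ((k + 2 : ℕ) : ℝ) - 1 = ((k + 1 : ℕ) : ℝ) := by push_cast; ring
  have hp2 : ((k + 2 : ℕ) : ℝ) + 1 = ((k + 3 : ℕ) : ℝ) := by push_cast; ring
  rw [hp1, hp2]
  set C : ℝ := ((k + 1 : ℕ) : ℝ) * L + θ + ((k + 2 : ℕ) : ℝ) * σmax with hC
  have hCpos : 0 < C := by
    have : 0 < σmax := hσ.trans_le hσ₂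
    positivity
  have hcoef : L + ((k : ℝ) + 2) * σk + θ ≤ C := by
    have h1 : 0 ≤ (k : ℝ) * L := by positivity
    have h2 : ((k : ℝ) + 2) * σk ≤ ((k : ℝ) + 2) * σmax := by gcongr
    rw [hC]
    push_cast
    linarith
  have hε : ε₂ / C ≤ ‖s‖ ^ (k + 1) := by
    rw [div_le_iff₀' hCpos]
    have := mul_le_mul_of_nonneg_right hcoef (by positivity : 0 ≤ ‖s‖ ^ (k + 1))
    linarith
  have hpow : (ε₂ / C) ^ (((k + 3 : ℕ) : ℝ) / ((k + 1 : ℕ) : ℝ)) ≤ ‖s‖ ^ (k + 3) := by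
    calc (ε₂ / C) ^ (((k + 3 : ℕ) : ℝ) / ((k + 1 : ℕ) : ℝ))
        ≤ (‖s‖ ^ (k + 1)) ^ (((k + 3 : ℕ) : ℝ) / ((k + 1 : ℕ) : ℝ)) := by gcongr
      _ = ‖s‖ ^ (k + 3) := by
        rw [← Real.rpow_natCast_mul hr.le, mul_div_cancel₀ _ (by positivity), Real.rpow_natCast]
  calc η₁ * σmin / ((k + 3 : ℕ) : ℝ) * (ε₂ / C) ^ (((k + 3 : ℕ) : ℝ) / ((k + 1 : ℕ) : ℝ))
      ≤ η₁ * σk / ((k + 3 : ℕ) : ℝ) * ‖s‖ ^ (k + 3) := by gcongr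
    _ = η₁ * (σk / ((k + 3 : ℕ) : ℝ) * ‖s‖ ^ (k + 3)) := by ring
    _ ≤ η₁ * (taylorP (k + 2) f x 0 - taylorP (k + 2) f x s) := by gcongr; rwa [hp2] at hdec
    _ ≤ f x - f (x + s) := hacc
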